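/- Let f ∈ C₊(ℝ), let k ≥ 1 be an integer, let α ∈ ℝ with α ∉ {−1, −2, −3, …}, and let γ ∈ ℂ. Suppose there is a polynomial p with complex coefficients, deg p ≤ k−1, such that (Γ(α+k+1)·f(x) − p(x))/x^{α+k} → γ as x → ∞. Then for every integer m ≥ 1 there is a polynomial q with complex coefficients, deg q ≤ k+m−1, such that (Γ(α+k+m+1)·(Hᵐ∗f)(x) − q(x))/x^{α+k+m} → γ as x → ∞, where (Hᵐ∗f)(x) = (1/(m−1)!)·∫₀ˣ (x−t)^{m−1} f(t) dt. -/

import Mathlib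

open Filter Topology Asymptotics Set MeasureTheory

theorem Polynomial.exists_derivative_eq {K : Type*} [Field K] [CharZero K] (p : Polynomial K) :
    ∃ P : Polynomial K, P.derivative = p ∧ P.natDegree ≤ p.natDegree + 1 := by
  refine ⟨∑ i ∈ Finset.range (p.natDegree + 1), monomial (i + 1) (p.coeff i / (i + 1)), ?_, ?_⟩
  · conv_rhs => rw [p.as_sum_range]
    rw [derivative_sum]
    refine Finset.sum_congr rfl fun i _ => ?_
    rw [derivative_monomial]
    have : (i + 1 : K) ≠ 0 := by exact_mod_cast i.succ_ne_zero
    simp [div_mul_cancel₀ _ this]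
  · refine natDegree_sum_le_of_forall_le _ _ fun i hi => (natDegree_monomial_le _).trans ?_
    have := Finset.mem_range.mp hi
    omega

theorem Polynomial.hasDerivAt_eval_ofReal (P : Polynomial ℂ) (x : ℝ) :
    HasDerivAt (fun t : ℝ => P.eval (t : ℂ)) (P.derivative.eval (x : ℂ)) x :=
  (P.hasDerivAt (x : ℂ)).comp_ofReal

theorem eventually_norm_sub_le_rpow_of_isLittleO_deriv {E : Type*} [NormedAddCommGroup E]
    [NormedSpace ℝ E] {G g : ℝ → E} {s : ℝ} (hs : s ≠ 0)
    (hG : ∀ x, 0 < x → HasDerivAt G (g x) x) (hg : g =o[atTop] fun x : ℝ => x ^ (s - 1))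
    {ε : ℝ} (hε : 0 < ε) :
    ∃ X > 0, ∀ x ≥ X, ∀ y ≥ x, ‖G y - G x‖ ≤ ε * (|s| / s * (y ^ s - x ^ s)) := by
  have hs' : 0 < |s| := abs_pos.mpr hs
  obtain ⟨X, hX⟩ := eventually_atTop.mp (hg.bound (mul_pos hε hs'))
  refine ⟨max X 1, by positivity, fun x hx y hy => ?_⟩
  have hx1 : 1 ≤ x := (le_max_right _ _).trans hx
  have hxX : X ≤ x := (le_max_left _ _).trans hx
  refine image_norm_le_of_norm_deriv_right_le_deriv_boundary' (f := fun t => G t - G x) (f' := g)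
    (B := fun t => ε * (|s| / s * (t ^ s - x ^ s)))
    (B' := fun t => ε * (|s| / s * (s * t ^ (s - 1)))) ?_ ?_ ?_ ?_ ?_ ?_ (right_mem_Icc.mpr hy)
  · exact fun t ht =>
      ((hG t (by linarith [ht.1])).continuousAt.sub continuousAt_const).continuousWithinAt
  · exact fun t ht => ((hG t (by linarith [ht.1])).sub_const _).hasDerivWithinAt
  · simp
  · refine fun t ht => ContinuousAt.continuousWithinAt ?_
    have : t ≠ 0 := by linarith [ht.1]
    fun_prop (disch := simp [this])
  · intro t ht
    have : t ≠ 0 := by linarith [ht.1]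
    exact (((Real.hasDerivAt_rpow_const (p := s) (Or.inl this)).sub_const _).const_mul
      _).const_mul _ |>.hasDerivWithinAt
  · intro t ht
    have ht0 : 0 < t := by linarith [ht.1]
    refine (hX t (hxX.trans ht.1)).trans (le_of_eq ?_)
    rw [Real.norm_of_nonneg (by positivity)]
    field_simp

theorem exists_sub_const_isLittleO_rpow_of_deriv {E : Type*} [NormedAddCommGroup E]
    [NormedSpace ℝ E] [CompleteSpace E] {G g : ℝ → E} {s : ℝ} (hs : s ≠ 0)
    (hG : ∀ x, 0 < x → HasDerivAt G (g x) x) (hg : g =o[atTop] fun x : ℝ => x ^ (s - 1)) :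
    ∃ C : E, (fun x => G x - C) =o[atTop] fun x : ℝ => x ^ s := by
  have key := fun ε (hε : (0 : ℝ) < ε) =>
    eventually_norm_sub_le_rpow_of_isLittleO_deriv hs hG hg hε
  rcases hs.lt_or_gt with hneg | hpos
  · rw [abs_of_neg hneg, neg_div_self hs] at key
    have hbound : ∀ ε > 0, ∃ X > 0, ∀ x ≥ X, ∀ y ≥ x, ‖G y - G x‖ ≤ ε * x ^ s := by
      intro ε hε
      obtain ⟨X, hX0, hX⟩ := key ε hε
      refine ⟨X, hX0, fun x hx y hy => (hX x hx y hy).trans ?_⟩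
      have : 0 ≤ y ^ s := Real.rpow_nonneg (by linarith) s
      gcongr
      linarith
    have hzero : Tendsto (fun x : ℝ => x ^ s) atTop (𝓝 0) := by
      simpa using tendsto_rpow_neg_atTop (neg_pos.mpr hneg)
    have hcauchy : CauchySeq G := by
      refine Metric.cauchySeq_iff'.mpr fun ε hε => ?_
      obtain ⟨X, -, hX⟩ := hbound 1 one_pos
      obtain ⟨N, hNε, hN⟩ := ((hzero.eventually_lt_const hε).and (eventually_ge_atTop X)).exists
      refine ⟨N, fun n hn => ?_⟩
      rw [dist_eq_norm]
      exact (hX N hN n hn).trans_lt (by simpa using hNε)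
    obtain ⟨C, hC⟩ := cauchySeq_tendsto_of_complete hcauchy
    refine ⟨C, isLittleO_iff.mpr fun ε hε => ?_⟩
    obtain ⟨X, hX0, hX⟩ := hbound ε hε
    filter_upwards [eventually_ge_atTop X] with x hx
    rw [Real.norm_of_nonneg (Real.rpow_nonneg (by linarith) s), norm_sub_rev]
    refine le_of_tendsto (hC.sub_const (G x)).norm ?_
    filter_upwards [eventually_ge_atTop x] with y hy using hX x hx y hy
  · rw [abs_of_pos hpos, div_self hs] at key
    refine ⟨0, isLittleO_iff.mpr fun ε hε => ?_⟩
    obtain ⟨X, hX0, hX⟩ := key (ε / 2) (half_pos hε)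
    have hinf : Tendsto (fun x : ℝ => ε / 2 * x ^ s) atTop atTop :=
      (tendsto_rpow_atTop hpos).const_mul_atTop (half_pos hε)
    filter_upwards [eventually_ge_atTop X, hinf.eventually_ge_atTop ‖G X‖] with x hx hx'
    rw [Real.norm_of_nonneg (Real.rpow_nonneg (by linarith) s), sub_zero]
    have h1 := hX X le_rfl x hx
    have h2 : ‖G x‖ ≤ ‖G X‖ + ‖G x - G X‖ := norm_le_insert' _ _
    have h3 : 0 ≤ ε / 2 * X ^ s := mul_nonneg (by positivity) (Real.rpow_nonneg hX0.le s)
    linarith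

theorem tendsto_div_rpow_iff_isLittleO {u : ℝ → ℂ} {γ : ℂ} {s : ℝ} :
    Tendsto (fun x : ℝ => u x / ((x ^ s : ℝ) : ℂ)) atTop (𝓝 γ) ↔
      (fun x : ℝ => u x - γ * ((x ^ s : ℝ) : ℂ)) =o[atTop] fun x : ℝ => x ^ s := by
  have hne : ∀ᶠ x : ℝ in atTop, ((x ^ s : ℝ) : ℂ) ≠ 0 := by
    filter_upwards [eventually_gt_atTop 0] with x hx
    exact_mod_cast (Real.rpow_pos_of_pos hx s).ne'
  rw [← tendsto_sub_nhds_zero_iff, ← Complex.isLittleO_ofReal_right,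
    isLittleO_iff_tendsto' (hne.mono fun x hx h0 => absurd h0 hx)]
  refine tendsto_congr' (hne.mono fun x hx => ?_)
  field_simp

theorem exists_polynomial_tendsto_integral_div_rpow {f : ℝ → ℂ} (hf : Continuous f)
    {c γ : ℂ} {β : ℝ} (hβ : β + 1 ≠ 0) {p : Polynomial ℂ}
    (h : Tendsto (fun x : ℝ => (c * f x - p.eval (x : ℂ)) / ((x ^ β : ℝ) : ℂ)) atTop (𝓝 γ)) :
    ∃ q : Polynomial ℂ, q.natDegree ≤ p.natDegree + 1 ∧
      Tendsto (fun x : ℝ => (((β + 1 : ℝ) : ℂ) * c * (∫ t in (0 : ℝ)..x, f t) -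
        q.eval (x : ℂ)) / ((x ^ (β + 1) : ℝ) : ℂ)) atTop (𝓝 γ) := by
  obtain ⟨P, hP, hPdeg⟩ := p.exists_derivative_eq
  rw [tendsto_div_rpow_iff_isLittleO] at h
  obtain ⟨C, hC⟩ := exists_sub_const_isLittleO_rpow_of_deriv (s := β + 1) hβ
    (G := fun x : ℝ => ((β + 1 : ℝ) : ℂ) * (c * (∫ t in (0 : ℝ)..x, f t) - P.eval (x : ℂ)) -
      γ * ((x ^ (β + 1) : ℝ) : ℂ))
    (g := fun x : ℝ => ((β + 1 : ℝ) : ℂ) *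
      (c * f x - p.eval (x : ℂ) - γ * ((x ^ β : ℝ) : ℂ)))
    (fun x hx => by
      have h1 := (hf.integral_hasStrictDerivAt 0 x).hasDerivAt.const_mul c
      have h2 := P.hasDerivAt_eval_ofReal x
      have h3 := ((Real.hasDerivAt_rpow_const (p := β + 1)
        (Or.inl hx.ne')).ofReal_comp).const_mul γ
      refine (((h1.fun_sub h2).const_mul ((β + 1 : ℝ) : ℂ)).fun_sub h3).congr_deriv ?_
      rw [hP, add_sub_cancel_right]
      push_cast
      ring)
    (by simpa only [add_sub_cancel_right] using h.const_mul_left _)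
  refine ⟨Polynomial.C ((β + 1 : ℝ) : ℂ) * P + Polynomial.C C, ?_, ?_⟩
  · rw [Polynomial.natDegree_add_C]
    exact (Polynomial.natDegree_C_mul_le _ _).trans hPdeg
  · rw [tendsto_div_rpow_iff_isLittleO]
    refine hC.congr_left fun x => ?_
    simp only [Polynomial.eval_add, Polynomial.eval_mul, Polynomial.eval_C]
    ring

theorem intervalIntegral_sub_pow_mul_eq {f : ℝ → ℂ} (hf : Continuous f) (n : ℕ) (x : ℝ) :
    ∫ t in (0 : ℝ)..x, ((x - t : ℝ) : ℂ) ^ (n + 1) * f t =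
      (n + 1) * ∫ t in (0 : ℝ)..x, ((x - t : ℝ) : ℂ) ^ n * ∫ r in (0 : ℝ)..t, f r := by
  have hu : ∀ t : ℝ, HasDerivAt (fun t : ℝ => ((x - t : ℝ) : ℂ) ^ (n + 1))
      (-((n + 1) * ((x - t : ℝ) : ℂ) ^ n)) t := fun t =>
    (((hasDerivAt_id t).const_sub x).ofReal_comp.fun_pow (n + 1)).congr_deriv (by simp)
  have hF := fun t => (hf.integral_hasStrictDerivAt 0 t).hasDerivAt
  rw [intervalIntegral.integral_mul_deriv_eq_deriv_mul (fun t _ => hu t) (fun t _ => hF t)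
    (Continuous.intervalIntegrable (by fun_prop) _ _) (hf.intervalIntegrable _ _),
    ← intervalIntegral.integral_const_mul]
  simp [mul_assoc]


/-- Consistency of Cesàro asymptotics with the choice of representatives: if
`(Γ(α+k+1) f(x) - p(x))/x^(α+k) → γ` for a polynomial `p` of degree `≤ k-1`, then for
each `m ≥ 1` there is a polynomial `q` of degree `≤ k+m-1` with
`(Γ(α+k+m+1) (Hᵐ∗f)(x) - q(x))/x^(α+k+m) → γ`, where
`(Hᵐ∗f)(x) = (1/(m-1)!) ∫₀ˣ (x-t)^(m-1) f(t) dt`. -/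
theorem stmt6 (f : ℝ → ℂ) (hf : Continuous f) (hf0 : ∀ x : ℝ, x < 0 → f x = 0)
    (k : ℕ) (hk : 1 ≤ k) (α : ℝ) (hα : ∀ n : ℕ, α ≠ -(n + 1 : ℝ)) (γ : ℂ)
    (h : ∃ p : Polynomial ℂ, p.degree ≤ (k - 1 : ℕ) ∧
      Filter.Tendsto (fun x : ℝ =>
        ((Real.Gamma (α + k + 1) : ℂ) * f x - p.eval (x : ℂ)) / ((x ^ (α + k) : ℝ) : ℂ))
        Filter.atTop (nhds γ)) :
    ∀ m : ℕ, 1 ≤ m → ∃ q : Polynomial ℂ, q.degree ≤ (k + m - 1 : ℕ) ∧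
      Filter.Tendsto (fun x : ℝ =>
        ((Real.Gamma (α + k + m + 1) : ℂ) *
            (((Nat.factorial (m - 1) : ℂ))⁻¹ *
              ∫ t in (0:ℝ)..x, ((x - t : ℝ) : ℂ) ^ (m - 1) * f t) -
          q.eval (x : ℂ)) / ((x ^ (α + k + m) : ℝ) : ℂ))
        Filter.atTop (nhds γ) := by
  intro m hm
  obtain ⟨m, rfl⟩ := Nat.exists_eq_add_of_le' hm
  clear hm hf0
  induction m generalizing f k with
  | zero =>
    obtain ⟨p, hp, h⟩ := h
    have hβ : α + k + 1 ≠ 0 := fun h0 => hα k (by linarith)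
    obtain ⟨q, hq, hlim⟩ := exists_polynomial_tendsto_integral_div_rpow hf hβ h
    refine ⟨q, Polynomial.natDegree_le_iff_degree_le.mp (hq.trans ?_), ?_⟩
    · have := Polynomial.natDegree_le_iff_degree_le.mpr hp
      omega
    · have hΓ : Real.Gamma (α + k + 1 + 1) = (α + k + 1) * Real.Gamma (α + k + 1) :=
        Real.Gamma_add_one hβ
      simpa [hΓ] using hlim
  | succ m ih =>
    obtain ⟨p, hp, h⟩ := h
    have hβ : α + k + 1 ≠ 0 := fun h0 => hα k (by linarith)
    obtain ⟨q, hq, hlim⟩ := exists_polynomial_tendsto_integral_div_rpow hf hβ h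
    have hF : Continuous fun x => ∫ t in (0:ℝ)..x, f t :=
      continuous_iff_continuousAt.mpr fun x =>
        (hf.integral_hasStrictDerivAt 0 x).hasDerivAt.continuousAt
    have hΓ : Real.Gamma (α + k + 1 + 1) = (α + k + 1) * Real.Gamma (α + k + 1) :=
      Real.Gamma_add_one hβ
    obtain ⟨r, hr, hrlim⟩ := ih _ hF (k + 1) k.succ_pos
      ⟨q, Polynomial.natDegree_le_iff_degree_le.mp (hq.trans (by
        have := Polynomial.natDegree_le_iff_degree_le.mpr hp
        omega)), by simpa [hΓ, ← add_assoc] using hlim⟩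
    refine ⟨r, hr.trans (by norm_cast; omega), hrlim.congr fun x => ?_⟩
    have hexp : α + ((k + 1 : ℕ) : ℝ) + ((m + 1 : ℕ) : ℝ) = α + k + ((m + 1 + 1 : ℕ) : ℝ) := by
      push_cast
      ring
    simp only [Nat.add_sub_cancel]
    have hm : (m + 1 : ℂ) ≠ 0 := by exact_mod_cast m.succ_ne_zero
    rw [hexp, intervalIntegral_sub_pow_mul_eq hf, Nat.factorial_succ]
    push_cast
    rw [mul_inv, mul_comm (m + 1 : ℂ)⁻¹, mul_assoc _ (m + 1 : ℂ)⁻¹, inv_mul_cancel_left₀ hm]
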